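/- arXiv:2406.17723 — 4 statements merged into one kernel-verified Lean document; each statement's English description precedes it below -/
import Mathlib

section
/- Any graph G with maximum degree at most 6 admits a subset M of its vertices with |M| ≥ |V(G)|/4 such that the induced subgraph G[M] has maximum degree at most 1. -/
/-- Number of ordered monochromatic adjacent pairs, split at a vertex `v`. -/
theorem split_aux {V : Type*} [Fintype V] [DecidableEq V] (G : SimpleGraph V)
    [DecidableRel G.Adj] (c : V → Fin 4) (v : V) :
    (∑ u, ∑ w, if G.Adj u w ∧ c u = c w then 1 else 0) =
      2 * ((G.neighborFinset v).filter (fun w => c w = c v)).card +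
      ∑ u ∈ Finset.univ.erase v, ∑ w ∈ Finset.univ.erase v,
        if G.Adj u w ∧ c u = c w then 1 else 0 := by
  have h1 : ∀ u, (∑ w, if G.Adj u w ∧ c u = c w then 1 else 0) =
      (if G.Adj u v ∧ c u = c v then 1 else 0) + ∑ w ∈ Finset.univ.erase v,
        if G.Adj u w ∧ c u = c w then 1 else 0 := fun u =>
    (Finset.add_sum_erase _ _ (Finset.mem_univ v)).symm
  have h2 : (∑ w, if G.Adj v w ∧ c v = c w then 1 else 0) =
      ((G.neighborFinset v).filter (fun w => c w = c v)).card := by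
    rw [← Finset.card_filter]
    congr 1
    ext w
    simp [eq_comm]
  have h3 : (∑ u ∈ Finset.univ.erase v, if G.Adj u v ∧ c u = c v then 1 else 0) =
      ((G.neighborFinset v).filter (fun w => c w = c v)).card := by
    rw [← Finset.card_filter]
    congr 1
    ext w
    simp only [Finset.mem_filter, Finset.mem_erase, Finset.mem_univ, and_true,
      SimpleGraph.mem_neighborFinset]
    constructor
    · rintro ⟨_, h, h'⟩
      exact ⟨h.symm, h'⟩
    · rintro ⟨h, h'⟩
      exact ⟨h.ne', h.symm, h'⟩
  rw [← Finset.add_sum_erase _ _ (Finset.mem_univ v), h2,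
    Finset.sum_congr rfl (fun u _ => h1 u), Finset.sum_add_distrib, h3]
  ring

/-- Any graph with maximum degree at most 6 has a subset `M` of its vertices with
`|M| ≥ |V|/4` inducing a subgraph of maximum degree at most 1. -/
theorem stmt2 {V : Type*} [Fintype V] [DecidableEq V] (G : SimpleGraph V)
    [DecidableRel G.Adj] (hD : ∀ v, G.degree v ≤ 6) :
    ∃ M : Finset V, Fintype.card V ≤ 4 * M.card ∧
      ∀ v ∈ M, ((G.neighborFinset v) ∩ M).card ≤ 1 := by
  obtain ⟨c, hc⟩ := Finite.exists_min (fun c : V → Fin 4 =>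
    ∑ u, ∑ w, if G.Adj u w ∧ c u = c w then 1 else 0)
  have key : ∀ v, ((G.neighborFinset v).filter (fun w => c w = c v)).card ≤ 1 := by
    intro v
    by_contra! hv
    have hle : ∀ k, ((G.neighborFinset v).filter (fun w => c w = c v)).card ≤
        ((G.neighborFinset v).filter (fun w => c w = k)).card := by
      intro k
      have h := hc (Function.update c v k)
      rw [split_aux G c v, split_aux G (Function.update c v k) v] at h
      have hR : (∑ u ∈ Finset.univ.erase v, ∑ w ∈ Finset.univ.erase v,
          if G.Adj u w ∧ Function.update c v k u = Function.update c v k w then 1 else 0) =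
          ∑ u ∈ Finset.univ.erase v, ∑ w ∈ Finset.univ.erase v,
          if G.Adj u w ∧ c u = c w then 1 else 0 := by
        refine Finset.sum_congr rfl fun u hu => Finset.sum_congr rfl fun w hw => ?_
        rw [Function.update_of_ne (Finset.ne_of_mem_erase hu),
          Function.update_of_ne (Finset.ne_of_mem_erase hw)]
      have hN : (G.neighborFinset v).filter
          (fun w => Function.update c v k w = Function.update c v k v) =
          (G.neighborFinset v).filter (fun w => c w = k) := by
        refine Finset.filter_congr fun w hw => ?_
        rw [Function.update_self, Function.update_of_ne]
        exact ((G.mem_neighborFinset v w).1 hw).ne'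
      rw [hR, hN] at h
      omega
    have hs := Finset.card_eq_sum_card_fiberwise (f := c) (s := G.neighborFinset v)
      (t := Finset.univ) (fun _ _ => by simp)
    rw [Fin.sum_univ_four, G.card_neighborFinset_eq_degree] at hs
    have := hD v
    have := hle 0
    have := hle 1
    have := hle 2
    have := hle 3
    omega
  have hs := Finset.card_eq_sum_card_fiberwise (f := c) (s := (Finset.univ : Finset V))
    (t := Finset.univ) (fun _ _ => by simp)
  obtain ⟨k, hk⟩ : ∃ k, Fintype.card V ≤ 4 * (Finset.univ.filter (fun w => c w = k)).card := by
    by_contra! h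
    rw [Fin.sum_univ_four, Finset.card_univ] at hs
    have := h 0
    have := h 1
    have := h 2
    have := h 3
    omega
  refine ⟨_, hk, fun v hv => ?_⟩
  have hv' : c v = k := by simpa using hv
  refine le_trans (Finset.card_le_card ?_) (key v)
  intro w hw
  simp only [Finset.mem_inter, Finset.mem_filter, Finset.mem_univ, true_and] at hw ⊢
  exact ⟨hw.1, hw.2.trans hv'.symm⟩
end

section
/- Let H be a graph with maximum degree at most 2 and let V1,…,Vn be pairwise disjoint subsets of V(H) with |Vi| ≥ 4 for all i. Then there exists an independent set R in H containing exactly one vertex from each Vi. -/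
/-- Independent transversal of the classes `{v ∈ W | c v = i}`, `i ∈ I`. -/
def HasIT {V ι : Type*} (G : SimpleGraph V) (W : Finset V) (c : V → ι) (I : Finset ι) : Prop :=
  ∃ f : ι → V, (∀ i ∈ I, f i ∈ W ∧ c (f i) = i) ∧ ∀ i ∈ I, ∀ j ∈ I, ¬ G.Adj (f i) (f j)

open Classical in
theorem haxell_aux {V ι : Type*} [Fintype V] (m : ℕ) : ∀ (I : Finset ι), I.card = m →
    ∀ (G : SimpleGraph V) (W : Finset V) (c : V → ι) (i0 : ι), i0 ∈ I → ¬ HasIT G W c I →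
    HasIT G W c (I.erase i0) →
    ∃ S : Finset ι, S ⊆ I ∧ i0 ∈ S ∧ ∃ D : Finset V, D.card + 2 ≤ 2 * S.card ∧
      ∀ v ∈ W, c v ∈ S → ∃ d ∈ D, G.Adj d v := by
  induction m with
  | zero =>
    intro I hI G W c i0 hi0
    simp at hI
    simp [hI] at hi0
  | succ m ih =>
    intro I hI G W c i0 hi0 hno hT0
    by_cases hv : ∃ x ∈ W, c x = i0
    swap
    · push Not at hv
      refine ⟨{i0}, by simpa using hi0, by simp, ∅, by simp, ?_⟩
      intro v hvW hc
      exact absurd (by simpa using hc) (hv v hvW)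
    obtain ⟨x, hxW, hcx⟩ := hv
    obtain ⟨G', hle, hmin⟩ := (Set.toFinite {K : SimpleGraph V | ¬ HasIT K W c I}).exists_le_minimal hno
    have hno' : ¬ HasIT G' W c I := hmin.prop
    obtain ⟨t, ht1, ht2⟩ := hT0
    have hy : ∃ y, G'.Adj x y := by
      by_contra hcon
      push Not at hcon
      apply hno'
      refine ⟨Function.update t i0 x, ?_, ?_⟩
      · intro i hi
        by_cases h : i = i0
        · subst h; simp [hxW, hcx]
        · simpa [h] using ht1 i (by simp [h, hi])
      · intro i hi j hj hadj
        by_cases h : i = i0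
        · subst h
          simp at hadj
          exact hcon _ hadj
        · by_cases h' : j = i0
          · subst h'
            simp at hadj
            exact hcon _ hadj.symm
          · simp [h, h'] at hadj
            exact ht2 i (by simp [h, hi]) j (by simp [h', hj]) (hle hadj)
    obtain ⟨y, hxy⟩ := hy
    have hdel : HasIT (G'.deleteEdges {s(x, y)}) W c I := by
      by_contra hcon
      have := hmin.le_of_le hcon (G'.deleteEdges_le _) hxy
      simp at this
    obtain ⟨f, hf1, hf2⟩ := hdel
    have hkey : ∀ a ∈ I, ∀ b ∈ I, G'.Adj (f a) (f b) → s(f a, f b) = s(x, y) := by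
      intro a ha b hb hab
      by_contra h
      exact hf2 a ha b hb (by simp only [SimpleGraph.deleteEdges_adj, Set.mem_singleton_iff]; exact ⟨hab, h⟩)
    have hb : ∃ b ∈ I, f i0 = x ∧ f b = y := by
      have : ∃ a ∈ I, ∃ b ∈ I, G'.Adj (f a) (f b) := by
        by_contra hcon
        push Not at hcon
        exact hno' ⟨f, hf1, hcon⟩
      obtain ⟨a, ha, b, hb, hab⟩ := this
      have h := hkey a ha b hb hab
      rw [Sym2.eq_iff] at h
      rcases h with ⟨h1, h2⟩ | ⟨h1, h2⟩
      · have : a = i0 := by rw [← (hf1 a ha).2, h1, hcx]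
        subst this
        exact ⟨b, hb, h1, h2⟩
      · have : b = i0 := by rw [← (hf1 b hb).2, h2, hcx]
        subst this
        exact ⟨a, ha, h2, h1⟩
    obtain ⟨b, hbI, hfx, hfy⟩ := hb
    have hbne : b ≠ i0 := by
      rintro rfl
      rw [← hfx, ← hfy] at hxy
      exact G'.loopless.irrefl _ hxy
    have hyW : y ∈ W := hfy ▸ (hf1 b hbI).1
    have hcy : c y = b := hfy ▸ (hf1 b hbI).2
    have hi0' : i0 ∈ I.erase b := by simp [hi0, hbne.symm]
    have hA : ¬ HasIT G' (W.filter (fun v => ¬ G'.Adj x v ∧ ¬ G'.Adj y v))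
      (fun v => if c v = b then i0 else c v) (I.erase b) := by
      rintro ⟨g, hg1, hg2⟩
      have hg3 : ∀ i ∈ I, i ≠ b → g i ∈ W ∧ ¬ G'.Adj x (g i) ∧ ¬ G'.Adj y (g i) := by
        intro i hi hib
        have := (hg1 i (by simp [hi, hib])).1
        simpa using this
      have hg4 : ∀ i ∈ I, i ≠ b → i ≠ i0 → c (g i) = i := by
        intro i hi hib hi0
        have := (hg1 i (by simp [hi, hib])).2
        by_cases h : c (g i) = b
        · simp [h] at this; exact absurd this.symm hi0
        · simpa [h] using this
      have hg5 : ∀ i ∈ I, i ≠ b → ∀ j ∈ I, j ≠ b → ¬ G'.Adj (g i) (g j) := by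
        intro i hi hib j hj hjb
        exact hg2 i (by simp [hi, hib]) j (by simp [hj, hjb])
      have hsw : ∀ u v, G'.Adj u v ↔ G'.Adj v u := fun u v => G'.adj_comm u v
      apply hno'
      by_cases h : c (g i0) = b
      · refine ⟨fun i => if i = i0 then x else if i = b then g i0 else g i, ?_, ?_⟩
        · intro i hi
          dsimp only
          have := hg3 i0 hi0 hbne.symm
          grind
        · intro i hi j hj
          dsimp only
          have := hg3 i0 hi0 hbne.symm
          have := G'.loopless.irrefl
          have := hg3 i hi
          have := hg3 j hj
          have := hg5 i hi
          have := hg5 i0 hi0 hbne.symm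
          grind
      · have hc0 : c (g i0) = i0 := by
          have := (hg1 i0 hi0').2
          simpa [h] using this
        refine ⟨fun i => if i = b then y else g i, ?_, ?_⟩
        · intro i hi
          dsimp only
          grind
        · intro i hi j hj
          dsimp only
          have := G'.loopless.irrefl
          grind
    have hB : HasIT G' (W.filter (fun v => ¬ G'.Adj x v ∧ ¬ G'.Adj y v))
      (fun v => if c v = b then i0 else c v) ((I.erase b).erase i0) := by
      refine ⟨f, ?_, ?_⟩
      · intro i hi
        simp only [Finset.mem_erase] at hi
        obtain ⟨h0, hb', hiI⟩ := hi
        have h1 := hf1 i hiI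
        refine ⟨?_, by simp [h1.2, hb']⟩
        have hx' : f i ≠ x := by intro h; rw [h, hcx] at h1; exact h0 h1.2.symm
        have hy' : f i ≠ y := by intro h; rw [h, hcy] at h1; exact hb' h1.2.symm
        have k1 := hkey i0 hi0 i hiI
        have k2 := hkey b hbI i hiI
        rw [hfx, Sym2.eq_iff] at k1
        rw [hfy, Sym2.eq_iff] at k2
        simp only [Finset.mem_filter]
        grind
      · intro i hi j hj hij
        simp only [Finset.mem_erase] at hi hj
        have k := hkey i hi.2.2 j hj.2.2 hij
        have h1 := hf1 i hi.2.2
        have h2 := hf1 j hj.2.2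
        rw [Sym2.eq_iff] at k
        grind
    obtain ⟨S, hSI, hS0, D, hD, hdom⟩ := ih (I.erase b) (by rw [Finset.card_erase_of_mem hbI]; omega) G'
      (W.filter (fun v => ¬ G'.Adj x v ∧ ¬ G'.Adj y v))
      (fun v => if c v = b then i0 else c v) i0 hi0' hA hB
    · have hbS : b ∉ S := fun h => by simpa using hSI h
      refine ⟨insert b S, ?_, by simp [hS0], insert x (insert y D), ?_, ?_⟩
      · intro i hi
        rcases Finset.mem_insert.1 hi with rfl | hi
        · exact hbI
        · exact Finset.mem_of_mem_erase (hSI hi)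
      · rw [Finset.card_insert_of_notMem hbS]
        have h1 := Finset.card_insert_le x (insert y D)
        have h2 := Finset.card_insert_le y D
        omega
      · intro v hvW hcv
        by_cases h1 : G'.Adj x v
        · exact ⟨x, by simp, hle h1⟩
        by_cases h2 : G'.Adj y v
        · exact ⟨y, by simp, hle h2⟩
        obtain ⟨d, hd, hdv⟩ := hdom v (by simp [hvW, h1, h2]) (by
          by_cases h : c v = b
          · simpa [h] using hS0
          · simpa [h] using hcv)
        exact ⟨d, by simp [hd], hle hdv⟩

/-- Haxell's theorem: if `H` has maximum degree at most 2 and `V₁, …, Vₙ` are pairwise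
disjoint vertex subsets each of size at least 4, then there is an independent set
containing exactly one vertex from each `Vᵢ`. -/
theorem stmt10 {V : Type*} [Fintype V] [DecidableEq V] (H : SimpleGraph V)
    [DecidableRel H.Adj] (hΔ : ∀ v, H.degree v ≤ 2)
    (n : ℕ) (Vs : Fin n → Finset V)
    (hdisj : ∀ i j, i ≠ j → Disjoint (Vs i) (Vs j))
    (hcard : ∀ i, 4 ≤ (Vs i).card) :
    ∃ R : Finset V, (∀ u ∈ R, ∀ v ∈ R, ¬ H.Adj u v) ∧
      ∀ i, (R ∩ Vs i).card = 1 := by 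
  classical
  rcases Nat.eq_zero_or_pos n with rfl | hn
  · exact ⟨∅, by simp, fun i => i.elim0⟩
  let z : Fin n := ⟨0, hn⟩
  obtain ⟨v0, -⟩ : (Vs z).Nonempty := Finset.card_pos.1 (by have := hcard z; omega)
  let W : Finset V := Finset.univ.biUnion Vs
  let c : V → Fin n := fun v => if h : ∃ i, v ∈ Vs i then h.choose else z
  have hc : ∀ i, ∀ v ∈ Vs i, c v = i := by
    intro i v hv
    have h : ∃ i, v ∈ Vs i := ⟨i, hv⟩
    have h1 : c v = h.choose := dif_pos h
    by_contra hne
    rw [h1] at hne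
    exact Finset.disjoint_left.1 (hdisj _ _ hne) h.choose_spec hv
  have hcW : ∀ v ∈ W, v ∈ Vs (c v) := by
    intro v hv
    obtain ⟨i, -, hi⟩ := Finset.mem_biUnion.1 hv
    rwa [hc i v hi]
  have hIT : HasIT H W c Finset.univ := by
    by_contra hno
    obtain ⟨I, -, hmin⟩ :=
      (Set.toFinite {I : Finset (Fin n) | ¬ HasIT H W c I}).exists_le_minimal hno
    have hI : ¬ HasIT H W c I := hmin.prop
    have hne : I.Nonempty := by
      rw [Finset.nonempty_iff_ne_empty]
      rintro rfl
      exact hI ⟨fun _ => v0, by simp, by simp⟩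
    obtain ⟨i0, hi0⟩ := hne
    have her : HasIT H W c (I.erase i0) := by
      by_contra hcon
      have := hmin.le_of_le hcon (Finset.erase_subset _ _) hi0
      simp at this
    obtain ⟨S, -, hS0, D, hD, hdom⟩ := haxell_aux _ I rfl H W c i0 hi0 hI (by convert her)
    have h1 : S.card * 4 ≤ (S.biUnion Vs).card := by
      rw [Finset.card_biUnion (fun i _ j _ hij => hdisj i j hij)]
      simpa using Finset.card_nsmul_le_sum S (fun i => (Vs i).card) 4 (fun i _ => hcard i)
    have h2 : S.biUnion Vs ⊆ D.biUnion (fun d => H.neighborFinset d) := by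
      intro v hv
      obtain ⟨i, hi, hvi⟩ := Finset.mem_biUnion.1 hv
      obtain ⟨d, hd, hdv⟩ := hdom v (Finset.mem_biUnion.2 ⟨i, Finset.mem_univ _, hvi⟩)
        (by rwa [hc i v hvi])
      exact Finset.mem_biUnion.2 ⟨d, hd, by simpa using hdv⟩
    have h3 : (D.biUnion (fun d => H.neighborFinset d)).card ≤ D.card * 2 :=
      Finset.card_biUnion_le_card_mul _ _ _ (fun d _ => by simpa using hΔ d)
    have h4 := Finset.card_le_card h2
    omega
  obtain ⟨f, hf1, hf2⟩ := hIT
  refine ⟨Finset.univ.image f, ?_, ?_⟩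
  · intro u hu v hv
    obtain ⟨i, -, rfl⟩ := Finset.mem_image.1 hu
    obtain ⟨j, -, rfl⟩ := Finset.mem_image.1 hv
    exact hf2 i (Finset.mem_univ _) j (Finset.mem_univ _)
  · intro i
    rw [Finset.card_eq_one]
    refine ⟨f i, ?_⟩
    ext v
    simp only [Finset.mem_inter, Finset.mem_image, Finset.mem_univ, true_and, Finset.mem_singleton]
    constructor
    · rintro ⟨⟨j, rfl⟩, hj⟩
      rw [← hc i _ hj, (hf1 j (Finset.mem_univ _)).2]
    · rintro rfl
      have h := hf1 i (Finset.mem_univ _)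
      exact ⟨⟨i, rfl⟩, by simpa [h.2] using hcW _ h.1⟩
end

section
/- Let H be a graph and V1,…,Vn pairwise disjoint subsets of V(H). For S ⊆ {1,…,n}, let H_S be the subgraph induced on ⋃_{i∈S} Vi with all edges inside each Vi (i ∈ S) deleted. If for all nonempty S ⊆ {1,…,n} the total domination number of H_S is at least 2|S| − 1, then (V1,…,Vn) has an ISR. -/
open Classical in
/-- Vertices of `T` with a neighbour in `W`. -/
noncomputable def hxNb {V : Type*} (G : SimpleGraph V) (W T : Finset V) : Finset V :=
  T.filter (fun t => ∃ w ∈ W, G.Adj w t)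

open Classical in
/-- `T` is an independent transversal of the classes in `J`. -/
def hxValid {V ι : Type*} (G : SimpleGraph V) (c : V → ι) (J : Finset ι) (T : Finset V) : Prop :=
  Set.InjOn c T ∧ T.image c = J ∧ ∀ u ∈ T, ∀ v ∈ T, ¬ G.Adj u v

lemma mem_hxNb {V : Type*} (G : SimpleGraph V) (W T : Finset V) (t : V) :
    t ∈ hxNb G W T ↔ t ∈ T ∧ ∃ w ∈ W, G.Adj w t := by
  simp [hxNb]

open Classical in
lemma hx_min {V ι : Type*} (G : SimpleGraph V) (c : V → ι) (J : Finset ι) (W T : Finset V)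
    (hT : hxValid G c J T) :
    ∃ T', hxValid G c J T' ∧ hxNb G W T' ⊆ hxNb G W T ∧
      ∀ T'', hxValid G c J T'' → hxNb G W T'' ⊆ hxNb G W T' → hxNb G W T'' = hxNb G W T' := by
  induction hk : (hxNb G W T).card using Nat.strong_induction_on generalizing T with
  | _ k ih =>
    by_cases h : ∀ T'', hxValid G c J T'' → hxNb G W T'' ⊆ hxNb G W T →
        hxNb G W T'' = hxNb G W T
    · exact ⟨T, hT, subset_rfl, h⟩
    · push Not at h
      obtain ⟨T2, h2, hs, hne⟩ := h
      have hlt := Finset.card_lt_card (hs.ssubset_of_ne hne)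
      obtain ⟨T3, h3, hs3, hm⟩ := ih _ (hk ▸ hlt) T2 h2 rfl
      exact ⟨T3, h3, hs3.trans hs, hm⟩

open Classical in
lemma hx_swap {V ι : Type*} (G : SimpleGraph V) (c : V → ι) (J : Finset ι) (T : Finset V)
    (hT : hxValid G c J T) (t w : V) (ht : t ∈ T) (hc : c t = c w)
    (hw : ∀ u ∈ T, ¬ G.Adj w u) : hxValid G c J (insert w (T.erase t)) := by
  obtain ⟨h1, h2, h3⟩ := hT
  refine ⟨?_, ?_, ?_⟩
  · intro x hx y hy hxy
    simp only [Finset.coe_insert, Finset.coe_erase, Set.mem_insert_iff, Set.mem_sdiff,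
      Finset.mem_coe, Set.mem_singleton_iff] at hx hy
    rcases hx with rfl | ⟨hx, hx'⟩ <;> rcases hy with rfl | ⟨hy, hy'⟩
    · rfl
    · exact absurd (h1 hy ht (hxy.symm.trans hc.symm)) hy'
    · exact absurd (h1 hx ht (hxy.trans hc.symm)) hx'
    · exact h1 hx hy hxy
  · rw [← h2, Finset.image_insert, ← hc, ← Finset.image_insert, Finset.insert_erase ht]
  · intro u hu v hv
    simp only [Finset.mem_insert, Finset.mem_erase] at hu hv
    rcases hu with rfl | ⟨-, hu⟩ <;> rcases hv with rfl | ⟨-, hv⟩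
    · exact G.irrefl
    · exact hw _ hv
    · exact fun h => hw _ hu h.symm
    · exact h3 _ hu _ hv

open Classical in
lemma hx_add {V ι : Type*} (G : SimpleGraph V) (c : V → ι) (J : Finset ι) (T : Finset V)
    (hT : hxValid G c J T) (w : V) (ha : c w ∉ J)
    (hw : ∀ u ∈ T, ¬ G.Adj w u) : hxValid G c (insert (c w) J) (insert w T) := by
  obtain ⟨h1, h2, h3⟩ := hT
  have hn : ∀ x ∈ T, c x ≠ c w := fun x hx h =>
    ha (h ▸ h2 ▸ Finset.mem_image_of_mem c hx)
  refine ⟨?_, ?_, ?_⟩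
  · intro x hx y hy hxy
    simp only [Finset.coe_insert, Set.mem_insert_iff, Finset.mem_coe] at hx hy
    rcases hx with rfl | hx <;> rcases hy with rfl | hy
    · rfl
    · exact absurd hxy.symm (hn _ hy)
    · exact absurd hxy (hn _ hx)
    · exact h1 hx hy hxy
  · rw [← h2, Finset.image_insert]
  · intro u hu v hv
    simp only [Finset.mem_insert] at hu hv
    rcases hu with rfl | hu <;> rcases hv with rfl | hv
    · exact G.irrefl
    · exact hw _ hv
    · exact fun h => hw _ hu h.symm
    · exact h3 _ hu _ hv

open Classical in
lemma hx_step {V ι : Type*} [Fintype V] (G : SimpleGraph V) (c : V → ι)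
    (hdom : ∀ S : Finset ι, S.Nonempty → ∀ X : Finset V, (∀ x ∈ X, c x ∈ S) →
      (∀ v, c v ∈ S → ∃ x ∈ X, G.Adj v x) → 2 * S.card - 1 ≤ X.card)
    (J : Finset ι) (a : ι) (ha : a ∉ J) (T₀ : Finset V) (hT₀ : hxValid G c J T₀) :
    ∃ T, hxValid G c (insert a J) T := by
  by_contra hno
  have key : ∀ k : ℕ, ∃ W T : Finset V, hxValid G c J T ∧
      (∀ T'', hxValid G c J T'' → hxNb G W T'' ⊆ hxNb G W T → hxNb G W T'' = hxNb G W T) ∧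
      W.card ≤ (hxNb G W T).card ∧
      (∀ w ∈ W, c w ∈ insert a ((hxNb G W T).image c)) ∧ k ≤ (hxNb G W T).card := by
    intro k
    induction k with
    | zero =>
      refine ⟨∅, T₀, hT₀, ?_, by simp, by simp, by simp⟩
      intro T'' _ _
      simp [hxNb]
    | succ k ih =>
      obtain ⟨W, T, hT, hmin, hWD, hWS, hk⟩ := ih
      have hDT : ∀ x ∈ hxNb G W T, x ∈ T := fun x hx => ((mem_hxNb ..).1 hx).1
      have hScard : (insert a ((hxNb G W T).image c)).card = (hxNb G W T).card + 1 := by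
        rw [Finset.card_insert_of_notMem, Finset.card_image_of_injOn]
        · exact hT.1.mono (fun x hx => hDT x hx)
        · intro h
          obtain ⟨x, hx, hxa⟩ := Finset.mem_image.1 h
          exact ha (hxa ▸ hT.2.1 ▸ Finset.mem_image_of_mem c (hDT x hx))
      obtain ⟨w, hwS, hw⟩ : ∃ w, c w ∈ insert a ((hxNb G W T).image c) ∧
          ∀ x ∈ W ∪ hxNb G W T, ¬ G.Adj w x := by
        by_contra hcon
        push Not at hcon
        have := hdom _ (Finset.insert_nonempty a _) (W ∪ hxNb G W T) (by
          intro x hx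
          rcases Finset.mem_union.1 hx with hx | hx
          · exact hWS x hx
          · exact Finset.mem_insert_of_mem (Finset.mem_image_of_mem c hx)) hcon
        have h2 := Finset.card_union_le W (hxNb G W T)
        omega
      obtain ⟨T', hT', hsub, hmin'⟩ := hx_min G c J (insert w W) T hT
      have hDeq : hxNb G W T' = hxNb G W T := by
        apply hmin T' hT'
        intro x hx
        rw [mem_hxNb] at hx ⊢
        obtain ⟨hx1, y, hy, hyx⟩ := hx
        have : x ∈ hxNb G (insert w W) T' :=
          (mem_hxNb ..).2 ⟨hx1, y, Finset.mem_insert_of_mem hy, hyx⟩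
        exact ⟨((mem_hxNb ..).1 (hsub this)).1, y, hy, hyx⟩
      have hss : hxNb G W T ⊆ hxNb G (insert w W) T' := by
        rw [← hDeq]
        intro x hx
        rw [mem_hxNb] at hx ⊢
        obtain ⟨hx1, y, hy, hyx⟩ := hx
        exact ⟨hx1, y, Finset.mem_insert_of_mem hy, hyx⟩
      have hex : ∃ u ∈ T', G.Adj w u := by
        by_contra hcon
        push Not at hcon
        rcases Finset.mem_insert.1 hwS with h | h
        · apply hno
          refine ⟨insert w T', ?_⟩
          rw [← h]
          exact hx_add G c J T' hT' w (h ▸ ha) hcon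
        · obtain ⟨t, ht, htc⟩ := Finset.mem_image.1 h
          have ht' : t ∈ hxNb G W T' := hDeq ▸ ht
          have htT' := ((mem_hxNb ..).1 ht').1
          have hv := hx_swap G c J T' hT' t w htT' htc hcon
          have hwW : ∀ y ∈ W, ¬ G.Adj y w := fun y hy h' =>
            hw y (Finset.mem_union_left _ hy) h'.symm
          have hsub2 : hxNb G W (insert w (T'.erase t)) ⊆ (hxNb G W T).erase t := by
            intro x hx
            rw [mem_hxNb] at hx
            obtain ⟨hx1, y, hy, hyx⟩ := hx
            rcases Finset.mem_insert.1 hx1 with rfl | hx1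
            · exact absurd hyx (hwW y hy)
            · rw [Finset.mem_erase] at hx1 ⊢
              exact ⟨hx1.1, hDeq ▸ (mem_hxNb ..).2 ⟨hx1.2, y, hy, hyx⟩⟩
          have heq := hmin _ hv (hsub2.trans (Finset.erase_subset _ _))
          rw [heq] at hsub2
          exact Finset.notMem_erase t _ (hsub2 ht)
      obtain ⟨u, huT, hwu⟩ := hex
      have hu1 : u ∈ hxNb G (insert w W) T' :=
        (mem_hxNb ..).2 ⟨huT, w, Finset.mem_insert_self _ _, hwu⟩
      have hu2 : u ∉ hxNb G W T := fun h => hw u (Finset.mem_union_right _ h) hwu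
      have hlt : (hxNb G W T).card < (hxNb G (insert w W) T').card :=
        Finset.card_lt_card (Finset.ssubset_iff_of_subset hss |>.2 ⟨u, hu1, hu2⟩)
      have hSS : insert a ((hxNb G W T).image c) ⊆
          insert a ((hxNb G (insert w W) T').image c) :=
        Finset.insert_subset_insert _ (Finset.image_subset_image hss)
      refine ⟨insert w W, T', hT', hmin', ?_, ?_, by omega⟩
      · have := Finset.card_insert_le w W
        omega
      · intro x hx
        rcases Finset.mem_insert.1 hx with rfl | hx
        · exact hSS hwS
        · exact hSS (hWS x hx)
  obtain ⟨W, T, _, _, _, _, h⟩ := key (Fintype.card V + 1)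
  have := Finset.card_le_univ (hxNb G W T)
  omega

open Classical in
lemma hx_main {V ι : Type*} [Fintype V] (G : SimpleGraph V) (c : V → ι)
    (hdom : ∀ S : Finset ι, S.Nonempty → ∀ X : Finset V, (∀ x ∈ X, c x ∈ S) →
      (∀ v, c v ∈ S → ∃ x ∈ X, G.Adj v x) → 2 * S.card - 1 ≤ X.card)
    (J : Finset ι) : ∃ T, hxValid G c J T := by
  induction J using Finset.induction_on with
  | empty => exact ⟨∅, by simp [hxValid]⟩
  | insert a J ha ih =>
    obtain ⟨T, hT⟩ := ih
    exact hx_step G c hdom J a ha T hT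

/-- Haxell's total-domination criterion for ISRs: let `V₁, …, Vₙ` be pairwise disjoint
subsets of `V(H)`, and for `S ⊆ [n]` let `H_S` be the subgraph induced on `⋃_{i∈S} Vᵢ`
with all edges inside each `Vᵢ` deleted. If for every nonempty `S` every total
dominating set of `H_S` has size at least `2|S| − 1`, then `(V₁, …, Vₙ)` has an ISR. -/
theorem stmt11 {V : Type*} [Fintype V] [DecidableEq V] (H : SimpleGraph V)
    (n : ℕ) (Vs : Fin n → Finset V)
    (hdisj : ∀ i j, i ≠ j → Disjoint (Vs i) (Vs j))
    (hdom : ∀ S : Finset (Fin n), S.Nonempty →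
      ∀ X : Finset V, (∀ x ∈ X, ∃ i ∈ S, x ∈ Vs i) →
        (∀ v : V, (∃ i ∈ S, v ∈ Vs i) →
          ∃ x ∈ X, H.Adj v x ∧ ¬ ∃ i ∈ S, v ∈ Vs i ∧ x ∈ Vs i) →
        2 * S.card - 1 ≤ X.card) :
    ∃ R : Finset V, (∀ u ∈ R, ∀ v ∈ R, ¬ H.Adj u v) ∧
      ∀ i, (R ∩ Vs i).card = 1 := by
  classical
  let U := {v : V // ∃ i, v ∈ Vs i}
  let c : U → Fin n := fun u => u.2.choose
  have hc : ∀ u : U, u.1 ∈ Vs (c u) := fun u => u.2.choose_spec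
  have hcu : ∀ (u : U) i, u.1 ∈ Vs i → c u = i := by
    intro u i hi
    by_contra hne
    exact Finset.disjoint_left.1 (hdisj _ _ hne) (hc u) hi
  let G : SimpleGraph U :=
    { Adj := fun u v => H.Adj u.1 v.1 ∧ c u ≠ c v
      symm := ⟨fun u v h => ⟨h.1.symm, h.2.symm⟩⟩
      loopless := ⟨fun u h => h.2 rfl⟩ }
  obtain ⟨T, h1, h2, h3⟩ := hx_main G c (by
    intro S hS X hX hd
    have := hdom S hS (X.map (Function.Embedding.subtype _)) (by
      intro x hx
      obtain ⟨y, hy, rfl⟩ := Finset.mem_map.1 hx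
      exact ⟨c y, hX y hy, hc y⟩) (by
      rintro v ⟨i, hi, hv⟩
      have hcv := hcu ⟨v, i, hv⟩ i hv
      obtain ⟨x, hx, hadj, hne⟩ := hd ⟨v, i, hv⟩ (by rw [hcv]; exact hi)
      refine ⟨x.1, Finset.mem_map.2 ⟨x, hx, rfl⟩, hadj, ?_⟩
      rintro ⟨j, _, hj, hj'⟩
      exact hne ((hcu _ j hj).trans (hcu _ j hj').symm))
    simpa using this) Finset.univ
  refine ⟨T.map (Function.Embedding.subtype _), ?_, ?_⟩
  · intro u hu v hv hadj
    obtain ⟨x, hx, rfl⟩ := Finset.mem_map.1 hu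
    obtain ⟨y, hy, rfl⟩ := Finset.mem_map.1 hv
    refine h3 x hx y hy ⟨hadj, fun h => ?_⟩
    have := h1 hx hy h
    subst this
    exact H.irrefl hadj
  · intro i
    have hi := Finset.mem_univ i
    rw [← h2] at hi
    obtain ⟨t, ht, hti⟩ := (@Finset.mem_image _ _ (_) _ _ _).1 hi
    rw [Finset.card_eq_one]
    refine ⟨t.1, ?_⟩
    ext x
    rw [Finset.mem_inter, Finset.mem_singleton]
    constructor
    · rintro ⟨hx, hxi⟩
      obtain ⟨y, hy, rfl⟩ := Finset.mem_map.1 hx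
      exact congrArg Subtype.val (h1 hy ht ((hcu y i hxi).trans hti.symm))
    · rintro rfl
      exact ⟨Finset.mem_map.2 ⟨t, ht, rfl⟩, hti ▸ hc t⟩
end

section
/- Let M be a subset of the vertex set of a graph F chosen so that (M1) F[M] has maximum degree at most 1, (M2) |M| is maximum subject to (M1), and (M3) F[M] has the minimum number of edges subject to (M1)–(M2). Then every vertex v ∉ M has at least two neighbours in M each of which itself has exactly one neighbour in M, or more precisely: every vertex v ∉ M has at least two edges to M in F. -/
/-- Let `M ⊆ V(F)` induce a subgraph of maximum degree at most 1 (M1), with `|M|`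
maximum subject to (M1) (M2), and the number of edges of `F[M]` minimum subject to
(M1)–(M2) (M3). Then every vertex `v ∉ M` has at least two neighbours in `M`. -/
theorem stmt12 {V : Type*} [Fintype V] [DecidableEq V] (F : SimpleGraph V)
    [DecidableRel F.Adj] (M : Finset V)
    (hM1 : ∀ v ∈ M, ((F.neighborFinset v) ∩ M).card ≤ 1)
    (hM2 : ∀ M' : Finset V,
      (∀ v ∈ M', ((F.neighborFinset v) ∩ M').card ≤ 1) → M'.card ≤ M.card)
    (hM3 : ∀ M' : Finset V,
      (∀ v ∈ M', ((F.neighborFinset v) ∩ M').card ≤ 1) → M'.card = M.card →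
      ((M ×ˢ M).filter fun p => F.Adj p.1 p.2).card ≤
        ((M' ×ˢ M').filter fun p => F.Adj p.1 p.2).card)
    (v : V) (hv : v ∉ M) :
    2 ≤ ((F.neighborFinset v) ∩ M).card := by
  by_contra hlt
  have hle : ((F.neighborFinset v) ∩ M).card ≤ 1 := by omega
  simp only [Finset.card_le_one, Finset.mem_inter, SimpleGraph.mem_neighborFinset] at hM1 hM2 hM3 hle
  by_cases h : ∃ m ∈ M, F.Adj v m ∧ ∃ m' ∈ M, F.Adj m m'
  · obtain ⟨m, hm, hvm, m', hm', hmm'⟩ := h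
    have hno : ∀ a ∈ M, a ≠ m → ¬ F.Adj v a := fun a ha hne hadj =>
      hne (hle a ⟨hadj, ha⟩ m ⟨hvm, hm⟩)
    have key := hM3 (insert v (M.erase m)) (by
      intro x hx a ha b hb
      simp only [Finset.mem_insert, Finset.mem_erase] at hx ha hb
      have := F.irrefl (v := v)
      have hs := fun y => F.adj_comm v y
      grind) (by
      rw [Finset.card_insert_of_notMem (by simp [hv]), Finset.card_erase_of_mem hm]
      have := Finset.card_pos.2 ⟨m, hm⟩
      omega)
    refine absurd key (not_le.2 (Finset.card_lt_card ?_))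
    rw [Finset.ssubset_iff_of_subset]
    · refine ⟨(m, m'), by simp [hm, hm', hmm'], ?_⟩
      have : m ≠ v := fun e => hv (e ▸ hm)
      simp [this]
    · rintro ⟨a, b⟩ hab
      simp only [Finset.mem_filter, Finset.mem_product, Finset.mem_insert, Finset.mem_erase] at hab ⊢
      have := F.irrefl (v := v)
      have hs := fun y => F.adj_comm v y
      grind
  · push Not at h
    have key := hM2 (insert v M) (by
      intro x hx a ha b hb
      simp only [Finset.mem_insert] at hx ha hb
      have := F.irrefl (v := v)
      have hs := fun y => F.adj_comm v y
      grind)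
    rw [Finset.card_insert_of_notMem hv] at key
    omega
end
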